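/- In the multilayer network M constructed from an Exact 3-Set Cover instance (U,S) with |U|=3k, |S|=m, 1 ≤ k ≤ m (as described in the context), let A* be any admissible edge set joining the evader v̂ to every contact in F = U ∪ W in at least one layer, and let x be the number of layers α_i in which A* joins v̂ to at least one node of U. Then in the resulting network M̂ the global closeness centrality of v̂ equals 3k + 3m + x/2 + (m−x)/3, and at least one node of M̂ has global closeness centrality strictly greater than that of v̂ if and only if x ≤ k. -/

import Mathlib

open scoped Classical ENNReal

/-- A multilayer network: `occ v α` means node `v` occurs in layer `α`;
`Edge` is the edge relation on occurrences. -/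
structure MLNet (V : Type*) (L : Type*) where
  occ : V → L → Prop
  Edge : V × L → V × L → Prop

namespace MLNet

variable {V : Type*} {L : Type*}

/-- The axioms of a multilayer network with diagonal couplings: the edge relation is
symmetric, has no self-loops, joins only occurrences, and inter-layer edges join
two occurrences of the same node. -/
def IsValid (M : MLNet V L) : Prop :=
  (∀ a b, M.Edge a b → M.Edge b a) ∧
  (∀ a, ¬ M.Edge a a) ∧
  (∀ a b, M.Edge a b → M.occ a.1 a.2 ∧ M.occ b.1 b.2) ∧
  (∀ a b, M.Edge a b → a.2 ≠ b.2 → a.1 = b.1)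

/-- The simple graph on occurrences given by the (symmetrized) edge relation. -/
def flat (M : MLNet V L) : SimpleGraph (V × L) := SimpleGraph.fromRel M.Edge

/-- Global degree centrality: the number of nodes `w ≠ v` such that some edge joins an
occurrence of `v` and an occurrence of `w`. -/
noncomputable def degGlobal (M : MLNet V L) (v : V) : ℕ :=
  {w : V | w ≠ v ∧ ∃ α β, M.Edge (v, α) (w, β) ∨ M.Edge (w, β) (v, α)}.ncard

/-- Multilayer distance: the least length of a path from an occurrence of `v` to an
occurrence of `w` (`⊤` if there is none). -/
noncomputable def mdist (M : MLNet V L) (v w : V) : ℕ∞ :=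
  ⨅ (α : L) (β : L) (_ : M.occ v α) (_ : M.occ w β), M.flat.edist (v, α) (w, β)

/-- Global closeness centrality, valued in `ℝ≥0∞` (so that `1/∞ = 0`). -/
noncomputable def closGlobal (M : MLNet V L) [Fintype V] (v : V) : ℝ≥0∞ :=
  ∑ w ∈ Finset.univ.filter (fun w => w ≠ v), ((M.mdist v w : ℝ≥0∞))⁻¹

variable [Fintype V] [Fintype L]

/-- The number of shortest multilayer paths between nodes `w` and `u`
(`0` if they are not connected). -/
noncomputable def numSP (M : MLNet V L) (w u : V) : ℕ :=
  ∑ α : L, ∑ β : L,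
    if M.occ w α ∧ M.occ u β then
      (M.flat.finsetWalkLength (M.mdist w u).toNat (w, α) (u, β)).card
    else 0

/-- The number of pairs `(v^γ, p)` where `p` is a shortest multilayer path between `w` and `u`
passing through the occurrence `v^γ`. -/
noncomputable def numSPthrough (M : MLNet V L) (v w u : V) : ℕ :=
  ∑ α : L, ∑ β : L,
    if M.occ w α ∧ M.occ u β then
      ∑ p ∈ M.flat.finsetWalkLength (M.mdist w u).toNat (w, α) (u, β),
        (Finset.univ.filter (fun γ : L => (v, γ) ∈ p.support)).card
    else 0

/-- Global betweenness centrality: the sum over unordered pairs `{w,u}` of connected nodes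
(distinct from `v`) of the fraction of shortest multilayer paths passing through an
occurrence of `v` (division by zero, for unconnected pairs, gives `0`). -/
noncomputable def betwGlobal (M : MLNet V L) (v : V) : ℝ :=
  (1 / 2) * ∑ w : V, ∑ u : V,
    if w ≠ v ∧ u ≠ v ∧ w ≠ u then (M.numSPthrough v w u : ℝ) / (M.numSP w u : ℝ) else 0

/-- The simple graph `G^α` of a single layer (nodes not occurring in `α` are isolated). -/
def layerGraph (M : MLNet V L) (α : L) : SimpleGraph V :=
  SimpleGraph.fromRel (fun v w => M.Edge (v, α) (w, α))

/-- Degree of a node in the graph of layer `α`. -/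
noncomputable def layerDeg (M : MLNet V L) (α : L) (v : V) : ℕ :=
  ((M.layerGraph α).neighborSet v).ncard

end MLNet

/-- `Admissible M ve F A`: `A` encodes a set of intra-layer edges joining the evader `ve`
to contacts; `(v, α) ∈ A` encodes the edge `(ve^α, v^α)`, which requires `v ∈ F` and
both `ve` and `v` to occur in layer `α`. -/
def Admissible {V L : Type*} (M : MLNet V L) (ve : V) (F : Set V) (A : Set (V × L)) : Prop :=
  ∀ p ∈ A, p.1 ∈ F ∧ M.occ ve p.2 ∧ M.occ p.1 p.2

/-- The network obtained from `M` by adding, for each `(v, α) ∈ A`, the edge `(ve^α, v^α)`. -/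
def MLNet.addEdges {V L : Type*} (M : MLNet V L) (ve : V) (A : Set (V × L)) : MLNet V L where
  occ := M.occ
  Edge a b := M.Edge a b ∨
    ∃ p ∈ A, (a = (ve, p.2) ∧ b = (p.1, p.2)) ∨ (b = (ve, p.2) ∧ a = (p.1, p.2))

/-- `A` joins the evader to every contact in at least one layer. -/
def ConnectsAll {V L : Type*} (F : Set V) (A : Set (V × L)) : Prop :=
  ∀ v ∈ F, ∃ α, (v, α) ∈ A

section SG

variable {V : Type*} [Fintype V]

/-- Closeness centrality in a simple graph, valued in `ℝ≥0∞` (so that `1/∞ = 0`). -/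
noncomputable def closSG (G : SimpleGraph V) (v : V) : ℝ≥0∞ :=
  ∑ w ∈ Finset.univ.filter (fun w => w ≠ v), ((G.edist v w : ℝ≥0∞))⁻¹

/-- The number of shortest paths between `w` and `u` in a simple graph
(`0` if they are not connected and distinct). -/
noncomputable def numSPsg (G : SimpleGraph V) (w u : V) : ℕ :=
  (G.finsetWalkLength (G.edist w u).toNat w u).card

/-- The number of shortest paths between `w` and `u` passing through `v`. -/
noncomputable def numSPsgThrough (G : SimpleGraph V) (v w u : V) : ℕ :=
  ((G.finsetWalkLength (G.edist w u).toNat w u).filter (fun p => v ∈ p.support)).card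

/-- Betweenness centrality in a simple graph: the sum over unordered pairs `{w,u}` of
connected vertices distinct from `v` of the fraction of shortest paths through `v`. -/
noncomputable def betwSG (G : SimpleGraph V) (v : V) : ℝ :=
  (1 / 2) * ∑ w : V, ∑ u : V,
    if w ≠ v ∧ u ≠ v ∧ w ≠ u then (numSPsgThrough G v w u : ℝ) / (numSPsg G w u : ℝ) else 0

end SG

namespace XC

/-- Nodes of the gadget: the universe `U`, nodes `W = {w_{i,1},w_{i,2},w_{i,3}}`,
`A = {a₁,…,a_m}`, `B = {b₁,…,b_{2k+2m}}`, `B' = {b'₁,…,b'_{k+2m+1}}`,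
`B'' = {b''₁,…,b''_{2k+m-1}}`, the evader `ve`, and the node `v'`. -/
inductive Node (k m : ℕ) where
  | u : Fin (3 * k) → Node k m
  | w : Fin m → Fin 3 → Node k m
  | a : Fin m → Node k m
  | b : Fin (2 * k + 2 * m) → Node k m
  | b' : Fin (k + 2 * m + 1) → Node k m
  | b'' : Fin (2 * k + m - 1) → Node k m
  | ve : Node k m
  | v' : Node k m
deriving DecidableEq, Fintype

/-- Layers: `some i` is the layer `αᵢ` (one per set `Sᵢ`), and `none` is the layer `β`. -/
abbrev Layer (m : ℕ) := Option (Fin m)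

variable {k m : ℕ}

/-- Occurrences: `u j` occurs in `αᵢ` iff `j ∈ S i`; `w i j` occurs only in `αᵢ`; the evader
and all nodes of `A` occur in every layer `αᵢ`; `v'` and all nodes of `B`, `B'`, `B''`
occur only in `β`. -/
def occ (S : Fin m → Finset (Fin (3 * k))) : Node k m → Layer m → Prop
  | .u j, some i => j ∈ S i
  | .w i _, some i' => i = i'
  | .a _, some _ => True
  | .ve, some _ => True
  | .b _, none => True
  | .b' _, none => True
  | .b'' _, none => True
  | .v', none => True
  | _, _ => False

/-- The intra-layer edges: in layer `αᵢ`, every occurring `u j` is joined to `aᵢ` and the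
nodes of `A` form a clique; in layer `β`, every `bᵢ` is joined to `v'`, every `b'ᵢ` to
`bᵢ`, and every `b''ᵢ` to `b'ᵢ`. -/
def edgeIntra (S : Fin m → Finset (Fin (3 * k))) :
    Node k m × Layer m → Node k m × Layer m → Prop
  | (.u j, some i), (.a i', some i'') => i' = i ∧ i'' = i ∧ j ∈ S i
  | (.a i₁, some t), (.a i₂, some t') => t = t' ∧ i₁ ≠ i₂
  | (.b _, none), (.v', none) => True
  | (.b' i, none), (.b j, none) => (i : ℕ) = (j : ℕ)
  | (.b'' i, none), (.b' j, none) => (i : ℕ) = (j : ℕ)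
  | _, _ => False

/-- The gadget multilayer network: the intra-layer edges together with the inter-layer
edges joining every two occurrences of the same node. -/
def M (S : Fin m → Finset (Fin (3 * k))) : MLNet (Node k m) (Layer m) where
  occ := occ S
  Edge p q := edgeIntra S p q ∨
    (p.1 = q.1 ∧ p.2 ≠ q.2 ∧ occ S p.1 p.2 ∧ occ S q.1 q.2)

/-- The contacts: all of `U ∪ W`. -/
def F : Set (Node k m) :=
  {x | (∃ j, x = Node.u j) ∨ (∃ i j, x = Node.w i j)}

/-- The Exact 3-Set Cover instance has a solution: `k` pairwise disjoint members of `S`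
covering `U`. -/
def HasExactCover (k m : ℕ) (S : Fin m → Finset (Fin (3 * k))) : Prop :=
  ∃ T : Finset (Fin m), T.card = k ∧
    (∀ i ∈ T, ∀ j ∈ T, i ≠ j → Disjoint (S i) (S j)) ∧
    (∀ x : Fin (3 * k), ∃ i ∈ T, x ∈ S i)

end XC

namespace MLNet

variable {V : Type*} {L : Type*}

/-- A function on occurrences that grows by at most one along edges and vanishes at the source
bounds the multilayer distance from below. -/
theorem le_mdist_of_potential (N : MLNet V L) (f : V × L → ℕ∞)
    (hf : ∀ p q, N.Edge p q → f q ≤ f p + 1 ∧ f p ≤ f q + 1) {v w : V} {d : ℕ∞}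
    (hv : ∀ α, f (v, α) = 0) (hw : ∀ β, N.occ w β → d ≤ f (w, β)) : d ≤ N.mdist v w := by
  have walk_bound : ∀ p q, ∀ c : N.flat.Walk p q, f q ≤ f p + c.length := by
    intro p q c
    induction c with
    | nil => simp
    | cons h c ih =>
      rename_i a b e
      have hab : f b ≤ f a + 1 := by
        rcases (SimpleGraph.fromRel_adj _ _ _).1 h with ⟨-, h | h⟩
        · exact (hf _ _ h).1
        · exact (hf _ _ h).2
      calc f e ≤ f b + c.length := ih
        _ ≤ f a + 1 + c.length := by gcongr
        _ = f a + (SimpleGraph.Walk.cons h c).length := by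
          rw [SimpleGraph.Walk.length_cons]; push_cast; ring
  refine le_iInf fun α => le_iInf fun β => le_iInf fun _ => le_iInf fun hβ => ?_
  refine le_iInf fun c => (hw β hβ).trans ?_
  simpa [hv α] using walk_bound _ _ c

theorem one_le_mdist (N : MLNet V L) {v w : V} (h : v ≠ w) : 1 ≤ N.mdist v w := by
  refine le_iInf fun α => le_iInf fun β => le_iInf fun _ => le_iInf fun _ => ?_
  exact Order.one_le_iff_pos.2 (SimpleGraph.edist_pos_of_ne fun e => h (congrArg Prod.fst e))

theorem two_le_mdist (N : MLNet V L) {v w : V} (h : v ≠ w)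
    (hE : ∀ p q, N.Edge p q → ¬ (p.1 = v ∧ q.1 = w) ∧ ¬ (q.1 = v ∧ p.1 = w)) :
    2 ≤ N.mdist v w := by
  refine N.le_mdist_of_potential
    (fun p => if p.1 = v then 0 else if p.1 = w then 2 else 1) ?_ (by simp)
    (by simp [h.symm])
  intro p q hpq
  obtain ⟨h1, h2⟩ := hE p q hpq
  split_ifs <;> tauto

theorem mdist_le_of_walk (N : MLNet V L) {v w : V} {α β : L} (hα : N.occ v α) (hβ : N.occ w β)
    (c : N.flat.Walk (v, α) (w, β)) : N.mdist v w ≤ c.length :=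
  (iInf_le_of_le α <| iInf_le_of_le β <| iInf_le_of_le hα <| iInf_le_of_le hβ le_rfl).trans
    (SimpleGraph.Walk.edist_le c)

theorem flat_adj_of_edge (N : MLNet V L) {p q : V × L} (hne : p ≠ q) (h : N.Edge p q) :
    N.flat.Adj p q :=
  (SimpleGraph.fromRel_adj _ _ _).2 ⟨hne, Or.inl h⟩

theorem inv_mdist_le (N : MLNet V L) {v w : V} {n : ℕ} (hn : 0 < n)
    (h : (n : ℕ∞) ≤ N.mdist v w) :
    ((N.mdist v w : ℝ≥0∞))⁻¹ ≤ ENNReal.ofReal (1 / n) := by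
  rw [one_div, ENNReal.ofReal_inv_of_pos (by exact_mod_cast hn), ENNReal.inv_le_inv,
    ENNReal.ofReal_natCast]
  simpa using ENat.toENNReal_le.2 h

theorem le_inv_mdist (N : MLNet V L) {v w : V} {n : ℕ} (hn : 0 < n)
    (h : N.mdist v w ≤ n) :
    ENNReal.ofReal (1 / n) ≤ ((N.mdist v w : ℝ≥0∞))⁻¹ := by
  rw [one_div, ENNReal.ofReal_inv_of_pos (by exact_mod_cast hn), ENNReal.inv_le_inv,
    ENNReal.ofReal_natCast]
  simpa using ENat.toENNReal_le.2 h

theorem closGlobal_le (N : MLNet V L) [Fintype V] (v : V) (g : V → ℝ) (hg : ∀ w, 0 ≤ g w)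
    (h : ∀ w, w ≠ v → ((N.mdist v w : ℝ≥0∞))⁻¹ ≤ ENNReal.ofReal (g w)) :
    N.closGlobal v ≤ ENNReal.ofReal (∑ w, g w) := by
  rw [ENNReal.ofReal_sum_of_nonneg fun w _ => hg w, closGlobal]
  refine (Finset.sum_le_sum fun w hw => h w (Finset.mem_filter.1 hw).2).trans ?_
  exact Finset.sum_le_sum_of_subset (Finset.filter_subset _ _)

theorem le_closGlobal (N : MLNet V L) [Fintype V] (v : V) (g : V → ℝ) (hg : ∀ w, 0 ≤ g w)
    (hv : g v = 0) (h : ∀ w, w ≠ v → ENNReal.ofReal (g w) ≤ ((N.mdist v w : ℝ≥0∞))⁻¹) :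
    ENNReal.ofReal (∑ w, g w) ≤ N.closGlobal v := by
  rw [ENNReal.ofReal_sum_of_nonneg fun w _ => hg w, closGlobal, Finset.sum_filter]
  refine Finset.sum_le_sum fun w _ => ?_
  split_ifs with hw
  · exact h w hw
  · rw [not_not.1 hw, hv]; simp

end MLNet

namespace XC

variable {k m : ℕ}

/-- The gadget nodes as a disjoint union of index types. -/
def nodeEquiv (k m : ℕ) : Node k m ≃
    Fin (3 * k) ⊕ (Fin m × Fin 3) ⊕ Fin m ⊕ Fin (2 * k + 2 * m) ⊕ Fin (k + 2 * m + 1) ⊕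
      Fin (2 * k + m - 1) ⊕ Unit ⊕ Unit where
  toFun
    | .u j => .inl j
    | .w i t => .inr (.inl (i, t))
    | .a i => .inr (.inr (.inl i))
    | .b i => .inr (.inr (.inr (.inl i)))
    | .b' i => .inr (.inr (.inr (.inr (.inl i))))
    | .b'' i => .inr (.inr (.inr (.inr (.inr (.inl i)))))
    | .ve => .inr (.inr (.inr (.inr (.inr (.inr (.inl ()))))))
    | .v' => .inr (.inr (.inr (.inr (.inr (.inr (.inr ()))))))
  invFun
    | .inl j => .u j
    | .inr (.inl p) => .w p.1 p.2
    | .inr (.inr (.inl i)) => .a i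
    | .inr (.inr (.inr (.inl i))) => .b i
    | .inr (.inr (.inr (.inr (.inl i)))) => .b' i
    | .inr (.inr (.inr (.inr (.inr (.inl i))))) => .b'' i
    | .inr (.inr (.inr (.inr (.inr (.inr (.inl _)))))) => .ve
    | .inr (.inr (.inr (.inr (.inr (.inr (.inr _)))))) => .v'
  left_inv n := by cases n <;> rfl
  right_inv s := by
    rcases s with _ | _ | _ | _ | _ | _ | _ | _ <;> rfl

theorem sum_node (g : Node k m → ℝ) :
    ∑ n, g n = ∑ j, g (.u j) + (∑ i, ∑ t, g (.w i t) + (∑ i, g (.a i) + (∑ i, g (.b i) +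
      (∑ i, g (.b' i) + (∑ i, g (.b'' i) + (g .ve + g .v')))))) := by
  rw [← (nodeEquiv k m).symm.sum_comp g]
  simp only [Fintype.sum_sum_type, Fintype.sum_prod_type, Finset.univ_unique, Finset.sum_singleton]
  rfl

/-- The possible shapes of an edge of the gadget with added evader edges. -/
inductive Link (S : Fin m → Finset (Fin (3 * k))) (A : Set (Node k m × Layer m)) :
    Node k m × Layer m → Node k m × Layer m → Prop where
  | evaderU (j i) : (Node.u j, some i) ∈ A → Link S A (.ve, some i) (.u j, some i)
  | evaderU' (j i) : (Node.u j, some i) ∈ A → Link S A (.u j, some i) (.ve, some i)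
  | evaderW (i t) : Link S A (.ve, some i) (.w i t, some i)
  | evaderW' (i t) : Link S A (.w i t, some i) (.ve, some i)
  | ua (j i) : Link S A (.u j, some i) (.a i, some i)
  | aa (i i' t) : Link S A (.a i, some t) (.a i', some t)
  | bv (i) : Link S A (.b i, none) (.v', none)
  | b'b (i : Fin (k + 2 * m + 1)) (j : Fin (2 * k + 2 * m)) :
      (i : ℕ) = (j : ℕ) → Link S A (.b' i, none) (.b j, none)
  | b''b' (i : Fin (2 * k + m - 1)) (j : Fin (k + 2 * m + 1)) :
      (i : ℕ) = (j : ℕ) → Link S A (.b'' i, none) (.b' j, none)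
  | inter (n α β) : occ S n α → occ S n β → Link S A (n, α) (n, β)

section

variable {S : Fin m → Finset (Fin (3 * k))} {A : Set (Node k m × Layer m)}

theorem link_of_edge (hA : Admissible (M S) Node.ve F A) {p q : Node k m × Layer m}
    (h : ((M S).addEdges Node.ve A).Edge p q) : Link S A p q := by
  rcases h with (h | ⟨h1, -, h2, h3⟩) | ⟨⟨n, α⟩, hp, h⟩
  · unfold edgeIntra at h
    split at h
    · obtain ⟨rfl, rfl, -⟩ := h; exact .ua _ _
    · obtain ⟨rfl, -⟩ := h; exact .aa _ _ _
    · exact .bv _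
    · exact .b'b _ _ h
    · exact .b''b' _ _ h
    · exact h.elim
  · obtain ⟨n, α⟩ := p
    obtain ⟨n', β⟩ := q
    obtain rfl : n = n' := h1
    exact .inter _ _ _ h2 h3
  · obtain ⟨hF, -, ho⟩ := hA _ hp
    rcases hF with ⟨j, hj⟩ | ⟨i, t, hj⟩
    · dsimp only at hj; subst hj
      rcases α with _ | i
      · exact ho.elim
      · rcases h with ⟨rfl, rfl⟩ | ⟨rfl, rfl⟩
        · exact .evaderU _ _ hp
        · exact .evaderU' _ _ hp
    · dsimp only at hj; subst hj
      rcases α with _ | i'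
      · exact ho.elim
      · obtain rfl : i = i' := ho
        rcases h with ⟨rfl, rfl⟩ | ⟨rfl, rfl⟩
        · exact .evaderW _ _
        · exact .evaderW' _ _

/-- Whether a node lies on the evader's side (layers `αᵢ`) of the gadget. -/
def evaderSide : Node k m → Bool
  | .u _ | .w _ _ | .a _ | .ve => true
  | _ => false

/-- Pairs of distinct nodes that may be joined by an edge. -/
def near : Node k m → Node k m → Prop
  | .u _, .a _ | .a _, .u _ | .a _, .a _ => True
  | .u _, .ve | .ve, .u _ | .w _ _, .ve | .ve, .w _ _ => True
  | .b _, .v' | .v', .b _ => True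
  | .b' i, .b j => (i : ℕ) = j
  | .b i, .b' j => (i : ℕ) = j
  | .b'' i, .b' j => (i : ℕ) = j
  | .b' i, .b'' j => (i : ℕ) = j
  | _, _ => False

theorem Link.near {p q : Node k m × Layer m} (h : Link S A p q) :
    p.1 = q.1 ∨ near p.1 q.1 ∧ near q.1 p.1 := by
  cases h <;> simp_all [XC.near]

theorem Link.evaderSide_eq {p q : Node k m × Layer m} (h : Link S A p q) :
    evaderSide p.1 = evaderSide q.1 := by
  cases h <;> rfl

theorem mdist_eq_top (hA : Admissible (M S) Node.ve F A) {v w : Node k m}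
    (h : evaderSide v ≠ evaderSide w) :
    ((M S).addEdges Node.ve A).mdist v w = ⊤ := by
  refine top_le_iff.1 (MLNet.le_mdist_of_potential _
    (fun p => if evaderSide p.1 = evaderSide v then 0 else ⊤) ?_ (by simp) (by simp [h.symm]))
  intro p q hpq
  simp [(link_of_edge hA hpq).evaderSide_eq]

theorem two_le_mdist_of_not_near (hA : Admissible (M S) Node.ve F A) {v w : Node k m}
    (hne : v ≠ w) (h : ¬ near v w) : 2 ≤ ((M S).addEdges Node.ve A).mdist v w := by
  refine MLNet.two_le_mdist _ hne fun p q hpq => ⟨?_, ?_⟩ <;> rintro ⟨rfl, rfl⟩ <;>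
    rcases (link_of_edge hA hpq).near with e | ⟨h1, h2⟩ <;> simp_all

/-- An upper bound for the contribution of the node `w` to the closeness of `v`. -/
noncomputable def weight (v w : Node k m) : ℝ :=
  if evaderSide v ≠ evaderSide w then 0 else if near v w then 1 else 1 / 2

theorem closGlobal_le_sum_weight (hA : Admissible (M S) Node.ve F A) (v : Node k m) :
    ((M S).addEdges Node.ve A).closGlobal v ≤ ENNReal.ofReal (∑ w, weight v w) := by
  refine MLNet.closGlobal_le _ _ _ (fun w => ?_) fun w hw => ?_
  · unfold weight; split_ifs <;> norm_num
  · unfold weight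
    split_ifs with h1 h2
    · simp [mdist_eq_top hA h1]
    · simpa using MLNet.inv_mdist_le (n := 1) ((M S).addEdges Node.ve A) one_pos
        (by exact_mod_cast MLNet.one_le_mdist _ hw.symm)
    · simpa using MLNet.inv_mdist_le (n := 2) ((M S).addEdges Node.ve A) two_pos
        (by exact_mod_cast two_le_mdist_of_not_near hA hw.symm h2)

theorem sum_ite_val_eq_le (n c : ℕ) :
    ∑ i : Fin n, (if c = (i : ℕ) then (1 : ℝ) else 1 / 2) ≤ n / 2 + 1 / 2 := by
  have h : ∀ i : Fin n, (if c = (i : ℕ) then (1 : ℝ) else 1 / 2) =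
      1 / 2 + if c = (i : ℕ) then 1 / 2 else 0 := fun i => by split_ifs <;> norm_num
  simp only [h, Finset.sum_add_distrib]
  rw [Fin.sum_univ_eq_sum_range (fun i => if c = i then (1 / 2 : ℝ) else 0) n, Finset.sum_ite_eq]
  simp only [Finset.sum_const, Finset.card_univ, Fintype.card_fin, nsmul_eq_mul]
  split_ifs <;> linarith

/-- Every node other than the evader and `v'` has at most the closeness that the evader has when
it is joined to `U` in more than `k` layers. -/
theorem sum_weight_le (hk : 1 ≤ k) (hkm : k ≤ m) {v : Node k m} (h : v ≠ .ve) (h' : v ≠ .v') :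
    ∑ w, weight v w ≤ 3 * k + 10 / 3 * m + (k + 1) / 6 := by
  have hk' : (1 : ℝ) ≤ k := by exact_mod_cast hk
  have hm' : (1 : ℝ) ≤ m := by exact_mod_cast hk.trans hkm
  have hc : ((2 * k + m - 1 : ℕ) : ℝ) = 2 * k + m - 1 := by
    rw [Nat.cast_sub (by omega)]; push_cast; ring
  rw [sum_node]
  cases v with
  | u j =>
    simp [weight, evaderSide, near]
    linarith
  | w i t =>
    simp [weight, evaderSide, near]
    linarith
  | a i =>
    simp [weight, evaderSide, near]
    linarith
  | b i =>
    have := sum_ite_val_eq_le (k + 2 * m + 1) i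
    simp [weight, evaderSide, near, hc] at this ⊢
    linarith
  | b' i =>
    have h1 := sum_ite_val_eq_le (2 * k + 2 * m) i
    have h2 := sum_ite_val_eq_le (2 * k + m - 1) i
    simp [weight, evaderSide, near, hc] at h1 h2 ⊢
    linarith
  | b'' i =>
    have := sum_ite_val_eq_le (k + 2 * m + 1) i
    simp [weight, evaderSide, near, hc] at this ⊢
    linarith
  | ve => exact absurd rfl h
  | v' => exact absurd rfl h'

theorem addEdges_edge_evader {n : Node k m} {α : Layer m} (h : (n, α) ∈ A) :
    ((M S).addEdges Node.ve A).Edge (.ve, α) (n, α) :=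
  Or.inr ⟨_, h, Or.inl ⟨rfl, rfl⟩⟩

theorem addEdges_edge_of_intra {p q : Node k m × Layer m} (h : edgeIntra S p q) :
    ((M S).addEdges Node.ve A).Edge p q :=
  Or.inl (Or.inl h)

theorem mdist_evader_of_mem_F (hA : Admissible (M S) Node.ve F A) (hAc : ConnectsAll F A)
    {n : Node k m} (hn : n ∈ F) : ((M S).addEdges Node.ve A).mdist .ve n = 1 := by
  have hne : Node.ve ≠ n := by
    rcases hn with ⟨j, rfl⟩ | ⟨i, t, rfl⟩ <;> simp
  refine le_antisymm ?_ (MLNet.one_le_mdist _ hne)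
  obtain ⟨α, hα⟩ := hAc n hn
  obtain ⟨-, h1, h2⟩ := hA _ hα
  simpa using MLNet.mdist_le_of_walk ((M S).addEdges Node.ve A) h1 h2 (SimpleGraph.Walk.cons
    (MLNet.flat_adj_of_edge ((M S).addEdges Node.ve A) (by simp [hne])
      (addEdges_edge_evader hα)) .nil)

theorem mdist_evader_a_of_joined (hA : Admissible (M S) Node.ve F A) {i : Fin m}
    (h : ∃ j, (Node.u j, some i) ∈ A) :
    ((M S).addEdges Node.ve A).mdist .ve (.a i) = 2 := by
  refine le_antisymm ?_ (two_le_mdist_of_not_near hA (by simp) (by simp [near]))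
  obtain ⟨j, hj⟩ := h
  obtain ⟨-, h1, h2⟩ := hA _ hj
  have e : edgeIntra S (.u j, some i) (.a i, some i) := ⟨rfl, rfl, h2⟩
  have c₁ := MLNet.flat_adj_of_edge ((M S).addEdges Node.ve A) (by simp) (addEdges_edge_evader hj)
  have c₂ := MLNet.flat_adj_of_edge ((M S).addEdges Node.ve A) (by simp) (addEdges_edge_of_intra e)
  exact MLNet.mdist_le_of_walk ((M S).addEdges Node.ve A) (v := .ve) (w := .a i)
    (α := some i) (β := some i) h1 trivial (.cons c₁ (.cons c₂ .nil))

/-- A lower bound for the distance from the evader, when the evader is not joined to `U` in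
layer `αᵢ`. -/
def evaderPotential (i : Fin m) (p : Node k m × Layer m) : ℕ∞ :=
  match p.1 with
  | .ve => 0
  | .w _ _ => 1
  | .u _ => if p.2 = some i then 2 else 1
  | .a i' => if i' = i then 3 else 2
  | _ => ⊤

theorem mdist_evader_a_of_not_joined (hk : 1 ≤ k) (hA : Admissible (M S) Node.ve F A)
    (hAc : ConnectsAll F A) {i : Fin m} (h : ¬ ∃ j, (Node.u j, some i) ∈ A) :
    ((M S).addEdges Node.ve A).mdist .ve (.a i) = 3 := by
  apply le_antisymm
  · obtain ⟨α, hα⟩ := hAc (.u ⟨0, by omega⟩) (Or.inl ⟨_, rfl⟩)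
    obtain ⟨-, h1, h2⟩ := hA _ hα
    rcases α with _ | i'
    · exact h2.elim
    have hi : i' ≠ i := by rintro rfl; exact h ⟨_, hα⟩
    have e : edgeIntra S (.u ⟨0, by omega⟩, some i') (.a i', some i') := ⟨rfl, rfl, h2⟩
    have e' : edgeIntra S (.a i', some i') (.a i, some i') := ⟨rfl, hi⟩
    have c₁ := MLNet.flat_adj_of_edge ((M S).addEdges Node.ve A) (by simp) (addEdges_edge_evader hα)
    have c₂ := MLNet.flat_adj_of_edge ((M S).addEdges Node.ve A) (by simp) (addEdges_edge_of_intra e)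
    have c₃ := MLNet.flat_adj_of_edge ((M S).addEdges Node.ve A) (by simp [hi])
      (addEdges_edge_of_intra e')
    exact MLNet.mdist_le_of_walk ((M S).addEdges Node.ve A) (v := .ve) (w := .a i)
      (α := some i') (β := some i') h1 trivial (.cons c₁ (.cons c₂ (.cons c₃ .nil)))
  · refine MLNet.le_mdist_of_potential _ (evaderPotential i) ?_ (fun _ => rfl)
      (by simp [evaderPotential])
    intro p q hpq
    cases link_of_edge hA hpq with
    | evaderU j i' hj =>
      have hi : i' ≠ i := by rintro rfl; exact h ⟨_, hj⟩
      simp [evaderPotential, hi]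
    | evaderU' j i' hj =>
      have hi : i' ≠ i := by rintro rfl; exact h ⟨_, hj⟩
      simp [evaderPotential, hi]
    | inter n α β =>
      cases n <;> simp [evaderPotential]
      split_ifs <;> norm_num
    | _ =>
      simp [evaderPotential]
      try (split_ifs <;> norm_num)

theorem closGlobal_evader (hk : 1 ≤ k) (hA : Admissible (M S) Node.ve F A)
    (hAc : ConnectsAll F A) :
    ((M S).addEdges Node.ve A).closGlobal .ve = ENNReal.ofReal (3 * k + 10 / 3 * m +
      (Finset.univ.filter (fun i : Fin m => ∃ j, (Node.u j, (some i : Layer m)) ∈ A)).card / 6) := by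
  let g : Node k m → ℝ
    | .u _ | .w _ _ => 1
    | .a i => if ∃ j, (Node.u j, (some i : Layer m)) ∈ A then 1 / 2 else 1 / 3
    | _ => 0
  have hg : ∀ n, 0 ≤ g n := by
    intro n
    cases n <;> simp only [g] <;> positivity
  have hterm : ∀ n, n ≠ Node.ve →
      ((((M S).addEdges Node.ve A).mdist .ve n : ℝ≥0∞))⁻¹ = ENNReal.ofReal (g n) := by
    intro n hn
    cases n with
    | u j => rw [mdist_evader_of_mem_F hA hAc (Or.inl ⟨_, rfl⟩)]; simp [g]
    | w i t => rw [mdist_evader_of_mem_F hA hAc (Or.inr ⟨_, _, rfl⟩)]; simp [g]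
    | a i =>
      simp only [g]
      split_ifs with h
      · rw [mdist_evader_a_of_joined hA h, one_div, ENNReal.ofReal_inv_of_pos (by norm_num)]
        norm_num
      · rw [mdist_evader_a_of_not_joined hk hA hAc h, one_div,
          ENNReal.ofReal_inv_of_pos (by norm_num)]
        norm_num
    | ve => exact absurd rfl hn
    | _ => rw [mdist_eq_top hA (by simp [evaderSide])]; simp [g]
  have hsum : ∑ n, g n = 3 * k + 10 / 3 * m +
      (Finset.univ.filter
        (fun i : Fin m => ∃ j, (Node.u j, (some i : Layer m)) ∈ A)).card / 6 := by
    have ha : ∀ i : Fin m, g (.a i) =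
        1 / 3 + if ∃ j, (Node.u j, (some i : Layer m)) ∈ A then 1 / 6 else 0 := by
      intro i
      simp only [g]
      split_ifs <;> norm_num
    rw [sum_node]
    simp only [ha, Finset.sum_add_distrib, ← Finset.sum_filter]
    simp [g]
    ring
  rw [← hsum]
  exact le_antisymm (MLNet.closGlobal_le _ _ g hg fun n hn => (hterm n hn).le)
    (MLNet.le_closGlobal _ _ g hg rfl fun n hn => (hterm n hn).ge)

theorem three_le_mdist_v'_b'' (hA : Admissible (M S) Node.ve F A) (i : Fin (2 * k + m - 1)) :
    3 ≤ ((M S).addEdges Node.ve A).mdist .v' (.b'' i) := by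
  let f : Node k m × Layer m → ℕ∞ := fun p => match p.1 with
    | .v' => 0
    | .b _ => 1
    | .b' _ => 2
    | .b'' _ => 3
    | _ => ⊤
  refine MLNet.le_mdist_of_potential _ f ?_ (fun _ => rfl) (by simp [f])
  intro p q hpq
  cases link_of_edge hA hpq with
  | inter n α β => simp [f]
  | _ => simp [f] <;> norm_num

theorem closGlobal_v' (hk : 1 ≤ k) (hkm : k ≤ m) (hA : Admissible (M S) Node.ve F A) :
    ((M S).addEdges Node.ve A).closGlobal .v' =
      ENNReal.ofReal (3 * k + 10 / 3 * m + (k + 1) / 6) := by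
  let g : Node k m → ℝ
    | .b _ => 1
    | .b' _ => 1 / 2
    | .b'' _ => 1 / 3
    | _ => 0
  have hg : ∀ n, 0 ≤ g n := by
    intro n
    cases n <;> simp only [g] <;> positivity
  have hsum : ∑ n, g n = 3 * k + 10 / 3 * m + (k + 1) / 6 := by
    have hc : ((2 * k + m - 1 : ℕ) : ℝ) = 2 * k + m - 1 := by
      rw [Nat.cast_sub (by omega)]; push_cast; ring
    rw [sum_node]
    simp [g, hc]
    ring
  have adj_b : ∀ i, ((M S).addEdges Node.ve A).flat.Adj (.v', none) (.b i, none) := fun i =>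
    (MLNet.flat_adj_of_edge ((M S).addEdges Node.ve A) (by simp)
      (addEdges_edge_of_intra (by trivial : edgeIntra S (.b i, none) (.v', none)))).symm
  have adj_b' : ∀ (i : Fin (2 * k + 2 * m)) (j : Fin (k + 2 * m + 1)), (i : ℕ) = j →
      ((M S).addEdges Node.ve A).flat.Adj (.b i, none) (.b' j, none) := fun i j h =>
    (MLNet.flat_adj_of_edge ((M S).addEdges Node.ve A) (by simp)
      (addEdges_edge_of_intra (p := (.b' j, none)) (q := (.b i, none)) h.symm)).symm
  have adj_b'' : ∀ (i : Fin (k + 2 * m + 1)) (j : Fin (2 * k + m - 1)), (i : ℕ) = j →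
      ((M S).addEdges Node.ve A).flat.Adj (.b' i, none) (.b'' j, none) := fun i j h =>
    (MLNet.flat_adj_of_edge ((M S).addEdges Node.ve A) (by simp)
      (addEdges_edge_of_intra (p := (.b'' j, none)) (q := (.b' i, none)) h.symm)).symm
  rw [← hsum]
  apply le_antisymm
  · refine MLNet.closGlobal_le _ _ g hg fun n hn => ?_
    cases n with
    | b i =>
      simpa [g] using MLNet.inv_mdist_le (n := 1) ((M S).addEdges Node.ve A) one_pos
        (by exact_mod_cast MLNet.one_le_mdist _ hn.symm)
    | b' i =>
      simpa [g] using MLNet.inv_mdist_le (n := 2) ((M S).addEdges Node.ve A) two_pos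
        (by exact_mod_cast two_le_mdist_of_not_near hA hn.symm (by simp [near]))
    | b'' i =>
      simpa [g] using MLNet.inv_mdist_le (n := 3) ((M S).addEdges Node.ve A) three_pos
        (by exact_mod_cast three_le_mdist_v'_b'' hA i)
    | v' => exact absurd rfl hn
    | _ => rw [mdist_eq_top hA (by simp [evaderSide])]; simp
  · refine MLNet.le_closGlobal _ _ g hg rfl fun n hn => ?_
    cases n with
    | b i =>
      simpa [g] using MLNet.le_inv_mdist (n := 1) _ one_pos
        (MLNet.mdist_le_of_walk ((M S).addEdges Node.ve A) (v := .v') (w := .b i)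
          (α := none) (β := none) trivial trivial (.cons (adj_b i) .nil))
    | b' i =>
      simpa [g] using MLNet.le_inv_mdist (n := 2) _ two_pos
        (MLNet.mdist_le_of_walk ((M S).addEdges Node.ve A) (v := .v') (w := .b' i)
          (α := none) (β := none) trivial trivial
          (.cons (adj_b ⟨i, by omega⟩) (.cons (adj_b' _ i rfl) .nil)))
    | b'' i =>
      simpa [g] using MLNet.le_inv_mdist (n := 3) _ three_pos
        (MLNet.mdist_le_of_walk ((M S).addEdges Node.ve A) (v := .v') (w := .b'' i)
          (α := none) (β := none) trivial trivial
          (.cons (adj_b ⟨i, by omega⟩) (.cons (adj_b' _ ⟨i, by omega⟩ rfl)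
            (.cons (adj_b'' _ i rfl) .nil))))
    | _ => simp [g]

end

end XC

/-- In the gadget network constructed from an Exact 3-Set Cover instance,
for every admissible edge set `A` joining the evader to every contact, if `x` is the number
of layers `αᵢ` in which `A` joins the evader to a node of `U`, then the evader's global
closeness centrality in the resulting network equals `3k + 3m + x/2 + (m-x)/3`, and some
node has strictly greater global closeness centrality than the evader iff `x ≤ k`. -/
theorem global_closeness_of_evader_in_gadget (k m : ℕ) (hk : 1 ≤ k) (hkm : k ≤ m)
    (S : Fin m → Finset (Fin (3 * k))) (hS : ∀ i, (S i).card = 3)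
    (A : Set (XC.Node k m × XC.Layer m))
    (hA : Admissible (XC.M S) XC.Node.ve XC.F A)
    (hAc : ConnectsAll XC.F A)
    (x : ℕ)
    (hx : x = (Finset.univ.filter
        (fun i : Fin m => ∃ j : Fin (3 * k), (XC.Node.u j, (some i : XC.Layer m)) ∈ A)).card) :
    ((XC.M S).addEdges XC.Node.ve A).closGlobal XC.Node.ve =
      ((3 * k + 3 * m : ℕ) : ℝ≥0∞) + (x : ℝ≥0∞) / 2 + (((m - x : ℕ)) : ℝ≥0∞) / 3 ∧
    ((∃ z : XC.Node k m,
        ((XC.M S).addEdges XC.Node.ve A).closGlobal XC.Node.ve <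
        ((XC.M S).addEdges XC.Node.ve A).closGlobal z) ↔ x ≤ k) := by
  have hve := XC.closGlobal_evader hk hA hAc
  rw [← hx] at hve
  have hv' := XC.closGlobal_v' hk hkm hA
  have hxm : x ≤ m := by
    rw [hx]
    simpa using Finset.card_filter_le (Finset.univ : Finset (Fin m)) _
  refine ⟨?_, ?_, ?_⟩
  · have e : ((3 * k + 3 * m : ℕ) : ℝ≥0∞) + (x : ℝ≥0∞) / 2 + (((m - x : ℕ)) : ℝ≥0∞) / 3 =
        ENNReal.ofReal (((3 * k + 3 * m : ℕ) : ℝ) + (x : ℝ) / 2 + ((m - x : ℕ) : ℝ) / 3) := by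
      rw [ENNReal.ofReal_add (by positivity) (by positivity),
        ENNReal.ofReal_add (by positivity) (by positivity),
        ENNReal.ofReal_div_of_pos two_pos, ENNReal.ofReal_div_of_pos three_pos]
      simp only [ENNReal.ofReal_natCast, ENNReal.ofReal_ofNat]
    rw [hve, e, Nat.cast_sub hxm]
    congr 1
    push_cast
    ring
  · rintro ⟨z, hz⟩
    by_contra! hkx
    have hkx' : (k : ℝ) + 1 ≤ x := by exact_mod_cast hkx
    refine absurd hz (not_lt.2 ?_)
    by_cases h1 : z = .ve
    · rw [h1]
    rw [hve]
    by_cases h2 : z = .v'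
    · rw [h2, hv']
      exact ENNReal.ofReal_le_ofReal (by linarith)
    · exact (XC.closGlobal_le_sum_weight hA z).trans
        (ENNReal.ofReal_le_ofReal ((XC.sum_weight_le hk hkm h1 h2).trans (by linarith)))
  · intro hxk
    have hxk' : (x : ℝ) ≤ k := by exact_mod_cast hxk
    refine ⟨.v', ?_⟩
    rw [hve, hv']
    exact (ENNReal.ofReal_lt_ofReal_iff (by positivity)).2 (by linarith)
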